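/- arXiv:1511.04950 — 2 statements merged into one kernel-verified Lean document; each statement's English description precedes it below -/
import Mathlib

section
/- Fix σ₁, σ₂ > 0, r ∈ ℝ, |ρ| < 1, Merton densities k₁, k₂, weight parameters η₁, η₂ > 1 and the weight η(x) = −(η₁|x₁| + η₂|x₂|). Set cᵢ = ∫_ℝ (e^{ηᵢ|y|}|y| + |e^y − 1|) kᵢ(y) dy for i = 1, 2. Then for all continuously differentiable compactly supported u, v : ℝ² → ℝ, the jump bilinear term satisfies |∫_{ℝ²} J[u](x) v(x) e^{2η(x)} dx| ≤ max(c₁, c₂) · (∫_{ℝ²} |∇u(x)|² e^{2η(x)} dx)^{1/2} · (∫_{ℝ²} v(x)² e^{2η(x)} dx)^{1/2}. -/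
open MeasureTheory

section L2
variable {α : Type*} [MeasurableSpace α] {μ : Measure α} {f g : α → ℝ}

theorem norm_toLp_two_eq_sqrt (hf : MemLp f 2 μ) :
    ‖hf.toLp f‖ = √(∫ x, f x ^ 2 ∂μ) := by
  rw [norm_eq_sqrt_real_inner, L2.inner_def]
  congr 1
  refine integral_congr_ae ?_
  filter_upwards [hf.coeFn_toLp] with x hx
  simp [hx, sq]

theorem sqrt_integral_add_sq_le (hf : MemLp f 2 μ) (hg : MemLp g 2 μ) :
    √(∫ x, (f x + g x) ^ 2 ∂μ) ≤ √(∫ x, f x ^ 2 ∂μ) + √(∫ x, g x ^ 2 ∂μ) := by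
  have h := norm_add_le (hf.toLp f) (hg.toLp g)
  rw [← MemLp.toLp_add, norm_toLp_two_eq_sqrt, norm_toLp_two_eq_sqrt, norm_toLp_two_eq_sqrt] at h
  exact h

theorem sqrt_integral_const_mul_sq (c : ℝ) (f : α → ℝ) :
    √(∫ x, (c * f x) ^ 2 ∂μ) = |c| * √(∫ x, f x ^ 2 ∂μ) := by
  simp_rw [mul_pow]
  rw [integral_const_mul, Real.sqrt_mul (sq_nonneg c), Real.sqrt_sq_eq_abs]

theorem abs_integral_mul_le_sqrt_mul_sqrt (hf : MemLp f 2 μ) (hg : MemLp g 2 μ) :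
    |∫ x, f x * g x ∂μ| ≤ √(∫ x, f x ^ 2 ∂μ) * √(∫ x, g x ^ 2 ∂μ) := by
  have h := abs_real_inner_le_norm (hf.toLp f) (hg.toLp g)
  rw [norm_toLp_two_eq_sqrt, norm_toLp_two_eq_sqrt, L2.inner_def] at h
  refine le_of_eq_of_le ?_ h
  congr 1
  refine integral_congr_ae ?_
  filter_upwards [hf.coeFn_toLp, hg.coeFn_toLp] with x hx hy
  simp [hx, hy, mul_comm]

end L2

theorem integral_intervalIntegral_swap {f : ℝ → ℝ → ℝ} (hf : Continuous f.uncurry) {y R : ℝ}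
    (hy : 0 ≤ y) (h0 : ∀ x, ∀ s ∈ Set.Icc 0 y, R < |x| → f x s = 0) :
    ∫ x, ∫ s in (0)..y, f x s = ∫ s in (0)..y, ∫ x, f x s := by
  simp_rw [intervalIntegral.integral_of_le hy]
  refine integral_integral_swap ?_
  have hK : IntegrableOn f.uncurry (Set.Icc (-R) R ×ˢ Set.Icc 0 y) (volume.prod volume) :=
    hf.continuousOn.integrableOn_compact (isCompact_Icc.prod isCompact_Icc)
  have h : IntegrableOn f.uncurry (Set.univ ×ˢ Set.Ioc 0 y) (volume.prod volume) := by
    refine hK.of_forall_sdiff_eq_zero (MeasurableSet.univ.prod measurableSet_Ioc) ?_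
    rintro ⟨x, s⟩ ⟨⟨-, hs⟩, hn⟩
    have hs' : s ∈ Set.Icc 0 y := ⟨hs.1.le, hs.2⟩
    refine h0 x s hs' ?_
    by_contra! hx
    exact hn ⟨abs_le.1 hx, hs'⟩
  rwa [IntegrableOn, ← Measure.prod_restrict, Measure.restrict_univ] at h

theorem exists_bound_abs_of_hasCompactSupport {g : ℝ → ℝ} (hc : HasCompactSupport g) :
    ∃ R, 0 ≤ R ∧ ∀ x, R < |x| → g x = 0 := by
  obtain ⟨R, hR⟩ := hc.isCompact.isBounded.subset_closedBall (0 : ℝ)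
  refine ⟨max R 0, le_max_right _ _, fun x hx => ?_⟩
  by_contra h
  have := hR (subset_tsupport g h)
  rw [mem_closedBall_zero_iff, Real.norm_eq_abs] at this
  exact absurd (this.trans (le_max_left R 0)) (not_le.2 hx)

theorem hasCompactSupport_intervalIntegral_translate {g : ℝ → ℝ} (hc : HasCompactSupport g)
    {φ : ℝ → ℝ → ℝ} {y : ℝ} (hy : 0 ≤ y) (hφ : ∀ x s, g (x + s) = 0 → φ x s = 0) :
    HasCompactSupport fun x => ∫ s in (0)..y, φ x s := by
  obtain ⟨R, hR0, hR⟩ := exists_bound_abs_of_hasCompactSupport hc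
  refine HasCompactSupport.intro (isCompact_Icc (a := -(R + y)) (b := R + y)) fun x hx => ?_
  have hx' : R + y < |x| := by
    by_contra! h
    exact hx (abs_le.1 h)
  refine intervalIntegral.integral_zero_ae (.of_forall fun s hs => hφ x s (hR _ ?_))
  rw [Set.uIoc_of_le hy] at hs
  have := abs_sub_abs_le_abs_sub x (-s)
  rw [abs_neg, abs_of_nonneg hs.1.le, sub_neg_eq_add] at this
  linarith [hs.2]

/-- Minkowski's inequality for a superposition of translations. -/
theorem sqrt_integral_sq_intervalIntegral_translate_le {g : ℝ → ℝ} (hg : Continuous g)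
    (hc : HasCompactSupport g) {W : ℝ → ℝ → ℝ} (hW : Continuous W.uncurry) {κ : ℝ → ℝ}
    (hκ : Continuous κ) {y : ℝ} (hy : 0 ≤ y) (hWκ : ∀ x, ∀ s ∈ Set.Icc 0 y, |W x s| ≤ κ s) :
    √(∫ x, (∫ s in (0)..y, W x s * g (x + s)) ^ 2) ≤
      (∫ s in (0)..y, κ s) * √(∫ x, g x ^ 2) := by
  obtain ⟨R, hR0, hR⟩ := exists_bound_abs_of_hasCompactSupport hc
  have hκ0 : ∀ s ∈ Set.Icc 0 y, 0 ≤ κ s := fun s hs => (abs_nonneg _).trans (hWκ 0 s hs)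
  have hA : 0 ≤ ∫ s in (0)..y, κ s := intervalIntegral.integral_nonneg hy hκ0
  have hsh : ∀ x, ∀ s ∈ Set.Icc 0 y, R + y < |x| → g (x + s) = 0 := by
    intro x s hs hx
    refine hR _ ?_
    have := abs_sub_abs_le_abs_sub x (-s)
    rw [abs_neg, abs_of_nonneg hs.1, sub_neg_eq_add] at this
    linarith [hs.2]
  have hpt : ∀ x, (∫ s in (0)..y, W x s * g (x + s)) ^ 2 ≤
      (∫ s in (0)..y, κ s) * ∫ s in (0)..y, κ s * g (x + s) ^ 2 := by
    intro x
    have hmem : ∀ f : ℝ → ℝ, Continuous f → MemLp f 2 (volume.restrict (Set.Ioc 0 y)) := by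
      intro f hf
      rw [memLp_two_iff_integrable_sq hf.aestronglyMeasurable]
      exact ((hf.pow 2).integrableOn_Icc (a := 0) (b := y)).mono_set Set.Ioc_subset_Icc_self
    have hcs := abs_integral_mul_le_sqrt_mul_sqrt (hmem (fun s => √(κ s)) (by fun_prop))
      (hmem (fun s => √(κ s) * |g (x + s)|) (by fun_prop))
    simp_rw [← intervalIntegral.integral_of_le hy] at hcs
    have e1 : ∫ s in (0)..y, √(κ s) ^ 2 = ∫ s in (0)..y, κ s := by
      refine intervalIntegral.integral_congr fun s hs => ?_
      rw [Set.uIcc_of_le hy] at hs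
      exact Real.sq_sqrt (hκ0 s hs)
    have e2 : ∫ s in (0)..y, (√(κ s) * |g (x + s)|) ^ 2 =
        ∫ s in (0)..y, κ s * g (x + s) ^ 2 := by
      refine intervalIntegral.integral_congr fun s hs => ?_
      rw [Set.uIcc_of_le hy] at hs
      simp only [mul_pow, Real.sq_sqrt (hκ0 s hs), sq_abs]
    have hB : 0 ≤ ∫ s in (0)..y, κ s * g (x + s) ^ 2 :=
      intervalIntegral.integral_nonneg hy fun s hs => mul_nonneg (hκ0 s hs) (sq_nonneg _)
    have hle : |∫ s in (0)..y, W x s * g (x + s)| ≤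
        |∫ s in (0)..y, √(κ s) * (√(κ s) * |g (x + s)|)| := by
      refine le_trans ?_ (le_abs_self _)
      refine (intervalIntegral.abs_integral_le_integral_abs hy).trans ?_
      have hWx : Continuous (W x) := hW.comp (Continuous.prodMk_right x)
      refine intervalIntegral.integral_mono_on hy
        (Continuous.intervalIntegrable (by fun_prop) _ _)
        (Continuous.intervalIntegrable (by fun_prop) _ _) fun s hs => ?_
      rw [← mul_assoc, Real.mul_self_sqrt (hκ0 s hs), abs_mul]
      exact mul_le_mul_of_nonneg_right (hWκ x s hs) (abs_nonneg _)
    have := hle.trans hcs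
    rw [e1, e2, ← Real.sqrt_mul hA] at this
    rw [← sq_abs]
    exact (Real.le_sqrt (abs_nonneg _) (mul_nonneg hA hB)).1 this
  have hsw : ∫ x, ∫ s in (0)..y, κ s * g (x + s) ^ 2 = (∫ s in (0)..y, κ s) * ∫ x, g x ^ 2 := by
    rw [integral_intervalIntegral_swap (R := R + y) (by fun_prop) hy
      (fun x s hs hx => by simp [hsh x s hs hx]), ← intervalIntegral.integral_mul_const]
    refine intervalIntegral.integral_congr fun s _ => ?_
    rw [integral_const_mul, integral_add_right_eq_self (fun x => g x ^ 2)]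
  have hcint : Integrable fun x => ∫ s in (0)..y, κ s * g (x + s) ^ 2 := by
    refine Continuous.integrable_of_hasCompactSupport
      (intervalIntegral.continuous_parametric_intervalIntegral_of_continuous' (by fun_prop) _ _)
      (hasCompactSupport_intervalIntegral_translate hc hy fun x s h => by simp [h])
  rw [← Real.sqrt_sq hA, ← Real.sqrt_mul (sq_nonneg _)]
  refine Real.sqrt_le_sqrt ?_
  calc _ ≤ ∫ x, (∫ s in (0)..y, κ s) * ∫ s in (0)..y, κ s * g (x + s) ^ 2 :=
        integral_mono_of_nonneg (.of_forall fun x => sq_nonneg _) (hcint.const_mul _)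
          (.of_forall hpt)
    _ = _ := by rw [integral_const_mul, hsw]; ring

/-- The average of the translates of `g` over `[0, y]` is within `√2 ‖g‖` of `g` in `L²`. -/
theorem sqrt_integral_sq_sub_translate_average_le {g : ℝ → ℝ} (hg : Continuous g)
    (hc : HasCompactSupport g) {y : ℝ} (hy : 0 ≤ y) :
    √(∫ x, ((∫ s in (0)..y, g (x + s)) - y * g x) ^ 2) ≤ √2 * y * √(∫ x, g x ^ 2) := by
  obtain ⟨R, hR0, hR⟩ := exists_bound_abs_of_hasCompactSupport hc
  have hsh : ∀ x t, R + |t| < |x| → g (x + t) = 0 := by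
    intro x t hx
    refine hR _ ?_
    have := abs_sub_abs_le_abs_sub x (-t)
    rw [abs_neg, sub_neg_eq_add] at this
    linarith
  set U : ℝ → ℝ := fun x => ∫ s in (0)..x, g s with hUdef
  have hU : ∀ x, HasDerivAt U (g x) x := fun x => hg.integral_hasStrictDerivAt 0 x |>.hasDerivAt
  have hUc : Continuous U := continuous_iff_continuousAt.2 fun x => (hU x).continuousAt
  have hF : ∀ x t, ∫ s in (0)..t, g (x + s) = U (x + t) - U x := by
    intro x t
    rw [intervalIntegral.integral_comp_add_left (fun s => g s), add_zero]
    exact intervalIntegral.integral_eq_sub_of_hasDerivAt (fun s _ => hU s)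
      (hg.intervalIntegrable _ _)
  set C : ℝ → ℝ := fun s => ∫ x, g x * g (x + s) with hCdef
  have hC : Continuous C := by
    have : C = fun s => ∫ x in Set.Icc (-R) R, g x * g (x + s) := by
      funext s
      refine (setIntegral_eq_integral_of_forall_compl_eq_zero fun x hx => ?_).symm
      rw [hR x (by by_contra! h; exact hx (abs_le.1 h)), zero_mul]
    rw [this]
    exact continuous_parametric_integral_of_continuous (f := fun s x => g x * g (x + s))
      (by fun_prop) isCompact_Icc
  have hmem : MemLp g 2 volume := hg.memLp_of_hasCompactSupport hc
  have hC0 : C 0 = ∫ x, g x ^ 2 := by simp [hCdef, sq]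
  have hC0' : 0 ≤ C 0 := hC0 ▸ integral_nonneg fun x => sq_nonneg _
  have hCle : ∀ s, -C 0 ≤ C s := by
    intro s
    have hm : MemLp (fun x => g (x + s)) 2 volume :=
      hmem.comp_measurePreserving (measurePreserving_add_right volume s)
    have := abs_integral_mul_le_sqrt_mul_sqrt hmem hm
    rw [integral_add_right_eq_self (fun x => g x ^ 2), ← hC0, Real.mul_self_sqrt hC0'] at this
    exact (abs_le.1 this).1
  set D : ℝ → ℝ := fun t => ∫ s in (0)..t, C s with hDdef
  have hD : ∀ t, HasDerivAt D (C t) t := fun t => hC.integral_hasStrictDerivAt 0 t |>.hasDerivAt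
  have hDc : Continuous D := continuous_iff_continuousAt.2 fun x => (hD x).continuousAt
  have hFshift : ∀ t, 0 ≤ t → ∫ x, (U (x + t) - U x) * g (x + t) = D t := by
    intro t ht
    simp_rw [← hF, ← intervalIntegral.integral_mul_const]
    rw [integral_intervalIntegral_swap (R := R + |t|) (by fun_prop) ht
      (fun x s _ hx => by rw [hsh x t hx, mul_zero])]
    have : ∀ s, ∫ x, g (x + s) * g (x + t) = C (t - s) := by
      intro s
      have := integral_add_right_eq_self (fun x => g x * g (x + (t - s))) (μ := volume) s
      simpa [add_assoc] using this
    simp_rw [this]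
    rw [intervalIntegral.integral_comp_sub_left C t]
    simp [hDdef]
  have hFg : ∫ x, (U (x + y) - U x) * g x = D y := by
    simp_rw [← hF, ← intervalIntegral.integral_mul_const]
    rw [integral_intervalIntegral_swap (R := R) (by fun_prop) hy
      (fun x s _ hx => by rw [hR x hx, mul_zero])]
    simp_rw [mul_comm (g (_ + _))]
    rfl
  have hFF : ∫ x, (U (x + y) - U x) ^ 2 = ∫ s in (0)..y, 2 * D s := by
    have hpt : ∀ x, (U (x + y) - U x) ^ 2 =
        ∫ s in (0)..y, 2 * ((U (x + s) - U x) * g (x + s)) := by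
      intro x
      rw [intervalIntegral.integral_eq_sub_of_hasDerivAt
        (f := fun s => (U (x + s) - U x) ^ 2) (fun s _ => ?_)
        (Continuous.intervalIntegrable (by fun_prop) _ _)]
      · simp
      · have := (((hU (x + s)).comp_const_add x s).sub_const (U x)).pow 2
        refine this.congr_deriv ?_
        push_cast
        ring
    simp_rw [hpt]
    rw [integral_intervalIntegral_swap (R := R + y) (by fun_prop) hy (fun x s hs hx => by
      rw [hsh x s (by rw [abs_of_nonneg hs.1]; linarith [hs.2])]; ring)]
    refine intervalIntegral.integral_congr fun s hs => ?_
    rw [Set.uIcc_of_le hy] at hs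
    rw [integral_const_mul, hFshift s hs.1]
  have hkey : 0 ≤ 2 * y * D y - (∫ s in (0)..y, 2 * D s) + y ^ 2 * C 0 := by
    have h : ∫ s in (0)..y, 2 * s * (C s + C 0) =
        2 * y * D y - (∫ s in (0)..y, 2 * D s) + y ^ 2 * C 0 := by
      have hd : ∀ t, HasDerivAt
          (fun t => 2 * t * D t - (∫ s in (0)..t, 2 * D s) + t ^ 2 * C 0)
          (2 * t * (C t + C 0)) t := by
        intro t
        have h1 := ((hasDerivAt_id t).const_mul 2).mul (hD t)
        have h2 : HasDerivAt (fun t => ∫ s in (0)..t, 2 * D s) (2 * D t) t :=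
          ((hDc.const_mul 2).integral_hasStrictDerivAt 0 t).hasDerivAt
        have h3 := (hasDerivAt_pow 2 t).mul_const (C 0)
        refine ((h1.sub h2).add h3).congr_deriv ?_
        simp only [id]
        push_cast
        ring
      rw [intervalIntegral.integral_eq_sub_of_hasDerivAt (fun s _ => hd s)
        (Continuous.intervalIntegrable (by fun_prop) _ _)]
      simp
    rw [← h]
    exact intervalIntegral.integral_nonneg hy fun s hs =>
      mul_nonneg (by linarith [hs.1]) (by linarith [hCle s])
  have hFint : Integrable fun x => (U (x + y) - U x) ^ 2 := by
    have h := hasCompactSupport_intervalIntegral_translate hc hy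
      (φ := fun x s => g (x + s)) fun x s h => h
    simp_rw [hF] at h
    refine Continuous.integrable_of_hasCompactSupport (by fun_prop) ?_
    exact h.comp_left (g := fun z => z ^ 2) (by simp)
  have hFgint : Integrable fun x => (U (x + y) - U x) * g x :=
    Continuous.integrable_of_hasCompactSupport (by fun_prop) hc.mul_left
  have hexp : ∫ x, ((∫ s in (0)..y, g (x + s)) - y * g x) ^ 2 =
      (∫ s in (0)..y, 2 * D s) - 2 * y * D y + y ^ 2 * C 0 := by
    simp_rw [hF]
    rw [← hFF, ← hFg, hC0, ← integral_const_mul, ← integral_const_mul,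
      ← integral_sub hFint (hFgint.const_mul _)]
    rw [← integral_add (f := fun x => (U (x + y) - U x) ^ 2 - 2 * y * ((U (x + y) - U x) * g x))
      (hFint.sub (hFgint.const_mul _)) (hmem.integrable_sq.const_mul _)]
    congr 1
    funext x
    ring
  rw [hexp, ← hC0]
  refine Real.sqrt_le_iff.2 ⟨by positivity, ?_⟩
  rw [mul_pow, mul_pow, Real.sq_sqrt hC0', Real.sq_sqrt two_pos.le]
  linarith

theorem two_mul_exp_sub_one_le {h : ℝ} (hh : 0 ≤ h) :
    2 * (Real.exp h - 1) ≤ h * (Real.exp h + 1) := by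
  have hd : ∀ t, HasDerivAt (fun t => t * (Real.exp t + 1) - 2 * (Real.exp t - 1))
      (1 * (Real.exp t + 1) + t * Real.exp t - 2 * Real.exp t) t := fun t =>
    ((hasDerivAt_id t).mul ((Real.hasDerivAt_exp t).add_const 1)).sub
      (((Real.hasDerivAt_exp t).sub_const 1).const_mul 2)
  have hmono : MonotoneOn (fun t => t * (Real.exp t + 1) - 2 * (Real.exp t - 1)) (Set.Ici 0) := by
    refine monotoneOn_of_deriv_nonneg (convex_Ici 0) (by fun_prop)
      (fun t _ => (hd t).differentiableAt.differentiableWithinAt) fun t _ => ?_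
    rw [(hd t).deriv]
    have h1 := Real.add_one_le_exp (-t)
    have h2 : Real.exp (-t) * Real.exp t = 1 := by rw [← Real.exp_add]; simp
    nlinarith [Real.exp_pos t]
  have := hmono (Set.mem_Ici.2 le_rfl) (Set.mem_Ici.2 hh) hh
  simp at this
  linarith

theorem abs_exp_sub_one_le_exp_sub_one {z t : ℝ} (h : |z| ≤ t) :
    |Real.exp z - 1| ≤ Real.exp t - 1 := by
  have h1 := Real.exp_le_exp.2 (abs_le.1 h).2
  have h2 := Real.exp_le_exp.2 (abs_le.1 h).1
  have h3 := Real.exp_pos t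
  have h4 : Real.exp (-t) * Real.exp t = 1 := by rw [← Real.exp_add]; simp
  rw [abs_le]
  constructor <;> nlinarith [sq_nonneg (Real.exp t - 1), Real.exp_pos (-t)]

theorem exp_sub_one_le_exp_mul_sub_one_div {η : ℝ} (hη : 1 ≤ η) (y : ℝ) :
    Real.exp y - 1 ≤ (Real.exp (η * y) - 1) / η := by
  have h := one_add_mul_self_le_rpow_one_add (s := Real.exp y - 1)
    (by linarith [Real.exp_pos y]) hη
  rw [add_sub_cancel, ← Real.exp_mul, mul_comm y] at h
  rw [le_div_iff₀ (by linarith)]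
  linarith

/-- Weighted `L²` bound for a compensated increment to the right, for any compensator `a` close
to the step `y`. -/
theorem sqrt_integral_compensated_increment_le {u : ℝ → ℝ} (hu : ContDiff ℝ 1 u)
    (hc : HasCompactSupport u) {η y a : ℝ} (hη : 1 ≤ η) (hy : 0 ≤ y) (ha : 0 ≤ a)
    (hay : |a - y| ≤ (Real.exp (η * y) - 1) / η - y) :
    √(∫ x, ((u (x + y) - u x - a * deriv u x) * Real.exp (-(η * |x|))) ^ 2) ≤
      (Real.exp (η * y) * y + a) / √2 * √(∫ x, (deriv u x * Real.exp (-(η * |x|))) ^ 2) := by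
  have hη0 : 0 < η := by linarith
  have hdu : Continuous (deriv u) := hu.continuous_deriv le_rfl
  set g : ℝ → ℝ := fun x => deriv u x * Real.exp (-(η * |x|)) with hgdef
  have hg : Continuous g := by fun_prop
  have hgc : HasCompactSupport g := hc.deriv.mul_right
  set N := √(∫ x, g x ^ 2) with hN
  have hN0 : 0 ≤ N := Real.sqrt_nonneg _
  set E : ℝ → ℝ := fun x => ∫ s in (0)..y, (Real.exp (η * (|x + s| - |x|)) - 1) * g (x + s)
    with hE
  set F : ℝ → ℝ := fun x => ∫ s in (0)..y, g (x + s) with hF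
  have hEmem : MemLp E 2 volume :=
    (intervalIntegral.continuous_parametric_intervalIntegral_of_continuous'
      (by fun_prop) _ _).memLp_of_hasCompactSupport
      (hasCompactSupport_intervalIntegral_translate hgc hy fun x s h => by simp [h])
  have hFmem : MemLp F 2 volume :=
    (intervalIntegral.continuous_parametric_intervalIntegral_of_continuous'
      (by fun_prop) _ _).memLp_of_hasCompactSupport
      (hasCompactSupport_intervalIntegral_translate hgc hy fun x s h => h)
  have hgmem : MemLp g 2 volume := hg.memLp_of_hasCompactSupport hgc
  have hpt : ∀ x, (u (x + y) - u x - a * deriv u x) * Real.exp (-(η * |x|)) =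
      E x + (F x - a * g x) := by
    intro x
    have hEF : E x + F x = (u (x + y) - u x) * Real.exp (-(η * |x|)) := by
      have hftc : ∫ s in (0)..y, deriv u (x + s) = u (x + y) - u x := by
        rw [intervalIntegral.integral_comp_add_left (deriv u), add_zero]
        exact intervalIntegral.integral_deriv_eq_sub
          (fun z _ => (hu.differentiable one_ne_zero) z) (hdu.intervalIntegrable _ _)
      rw [← hftc, ← intervalIntegral.integral_mul_const, hE, hF,
        ← intervalIntegral.integral_add (Continuous.intervalIntegrable (by fun_prop) _ _)
          (Continuous.intervalIntegrable (by fun_prop) _ _)]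
      refine intervalIntegral.integral_congr fun s _ => ?_
      simp only [hgdef]
      have : Real.exp (-(η * |x|)) =
          Real.exp (η * (|x + s| - |x|)) * Real.exp (-(η * |x + s|)) := by
        rw [← Real.exp_add]; ring_nf
      rw [this]
      ring
    rw [add_sub_assoc', hEF, hgdef]
    ring
  have hEle : √(∫ x, E x ^ 2) ≤ ((Real.exp (η * y) - 1) / η - y) * N := by
    have hκ : ∫ s in (0)..y, (Real.exp (η * s) - 1) = (Real.exp (η * y) - 1) / η - y := by
      rw [intervalIntegral.integral_sub (Continuous.intervalIntegrable (by fun_prop) _ _)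
        (by simp), intervalIntegral.integral_comp_mul_left _ hη0.ne']
      simp
      ring
    rw [← hκ]
    refine sqrt_integral_sq_intervalIntegral_translate_le hg hgc
      (W := fun x s => Real.exp (η * (|x + s| - |x|)) - 1) (by fun_prop) (by fun_prop) hy
      fun x s hs => abs_exp_sub_one_le_exp_sub_one ?_
    rw [abs_mul, abs_of_pos hη0]
    refine mul_le_mul_of_nonneg_left ?_ hη0.le
    simpa [abs_of_nonneg hs.1] using abs_abs_sub_abs_le (x + s) x
  have hFle : √(∫ x, F x ^ 2) ≤ y * N := by
    have := sqrt_integral_sq_intervalIntegral_translate_le hg hgc (W := fun _ _ => 1)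
      (by fun_prop) (κ := fun _ => 1) (by fun_prop) hy (by simp)
    simp only [one_mul, intervalIntegral.integral_const, sub_zero, smul_eq_mul, mul_one] at this
    exact this
  have hAle : √(∫ x, (F x - y * g x) ^ 2) ≤ √2 * y * N :=
    sqrt_integral_sq_sub_translate_average_le hg hgc hy
  have hAmem : MemLp (fun x => F x - y * g x) 2 volume := hFmem.sub (hgmem.const_mul y)
  have hPle : √(∫ x, (F x - a * g x) ^ 2) ≤ (√2 * min a y + |a - y|) * N := by
    rcases le_total y a with h | h
    · have h1 := sqrt_integral_add_sq_le hAmem (hgmem.const_mul (y - a))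
      rw [sqrt_integral_const_mul_sq, abs_sub_comm] at h1
      rw [min_eq_right h]
      calc _ = √(∫ x, (F x - y * g x + (y - a) * g x) ^ 2) := by congr 3; funext x; ring
        _ ≤ _ := by linarith
    · rcases hy.eq_or_lt with rfl | hy0
      · obtain rfl : a = 0 := le_antisymm h ha
        simpa using hFle
      have h1 := sqrt_integral_add_sq_le (hAmem.const_mul (a / y)) (hFmem.const_mul (1 - a / y))
      rw [sqrt_integral_const_mul_sq, sqrt_integral_const_mul_sq, abs_of_nonneg (by positivity),
        abs_of_nonneg (sub_nonneg.2 ((div_le_one hy0).2 h))] at h1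
      rw [min_eq_left h, abs_sub_comm, abs_of_nonneg (sub_nonneg.2 h)]
      calc _ = √(∫ x, (a / y * (F x - y * g x) + (1 - a / y) * F x) ^ 2) := by
            congr 3; funext x; field_simp; ring
        _ ≤ a / y * (√2 * y * N) + (1 - a / y) * (y * N) :=
            h1.trans (add_le_add (mul_le_mul_of_nonneg_left hAle (by positivity))
              (mul_le_mul_of_nonneg_left hFle (sub_nonneg.2 ((div_le_one hy0).2 h))))
        _ = _ := by field_simp
  simp_rw [hpt]
  refine (sqrt_integral_add_sq_le hEmem (hFmem.sub (hgmem.const_mul a))).trans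
    ((add_le_add hEle hPle).trans ?_)
  rw [← add_mul]
  refine mul_le_mul_of_nonneg_right ?_ hN0
  set ε := (Real.exp (η * y) - 1) / η - y with hε
  have hε2 : 2 * ε ≤ y * (Real.exp (η * y) - 1) := by
    have := two_mul_exp_sub_one_le (mul_nonneg hη0.le hy)
    have h2 : (Real.exp (η * y) - 1) / η ≤ y * (Real.exp (η * y) + 1) / 2 := by
      rw [div_le_iff₀ hη0]
      linarith
    linarith
  have hs2 : √2 ^ 2 = 2 := Real.sq_sqrt two_pos.le
  have hs0 : 0 < √2 := by positivity
  have hs1 : √2 ≤ 3 / 2 := Real.sqrt_le_iff.2 ⟨by norm_num, by norm_num⟩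
  have hs3 : 1 ≤ √2 := Real.one_le_sqrt.2 one_le_two
  rw [le_div_iff₀ hs0]
  have hε0 : 0 ≤ ε := (abs_nonneg _).trans hay
  rcases le_total y a with h | h
  · rw [min_eq_right h]
    rw [abs_of_nonneg (sub_nonneg.2 h)] at hay ⊢
    nlinarith [mul_le_mul_of_nonneg_left hay (sub_nonneg.2 hs3),
      mul_le_mul_of_nonneg_right hs1 hε0]
  · rw [min_eq_left h]
    rw [abs_sub_comm, abs_of_nonneg (sub_nonneg.2 h)] at hay ⊢
    nlinarith [mul_le_mul_of_nonneg_left hay (sub_nonneg.2 hs3),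
      mul_le_mul_of_nonneg_right hs1 hε0]

/-- Weighted `L²` bound for the compensated jump of size `y`. -/
theorem sqrt_integral_compensated_jump_le {u : ℝ → ℝ} (hu : ContDiff ℝ 1 u)
    (hc : HasCompactSupport u) {η : ℝ} (hη : 1 ≤ η) (y : ℝ) :
    √(∫ x, ((u (x + y) - u x - (Real.exp y - 1) * deriv u x) * Real.exp (-(η * |x|))) ^ 2) ≤
      (Real.exp (η * |y|) * |y| + |Real.exp y - 1|) / √2 *
        √(∫ x, (deriv u x * Real.exp (-(η * |x|))) ^ 2) := by
  rcases le_total 0 y with hy | hy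
  · have ha : 0 ≤ Real.exp y - 1 := by linarith [Real.add_one_le_exp y]
    rw [abs_of_nonneg hy, abs_of_nonneg ha]
    refine sqrt_integral_compensated_increment_le hu hc hη hy ha ?_
    rw [abs_of_nonneg (by linarith [Real.add_one_le_exp y])]
    linarith [exp_sub_one_le_exp_mul_sub_one_div hη y]
  · have ha : Real.exp y - 1 ≤ 0 := by linarith [Real.exp_le_one_iff.2 hy]
    rw [abs_of_nonpos hy, abs_of_nonpos ha]
    have hd : ∀ x, deriv (fun x => u (-x)) x = -deriv u (-x) := fun x => deriv_comp_neg u x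
    have h := sqrt_integral_compensated_increment_le (u := fun x => u (-x)) (hu.comp contDiff_neg)
      (hc.comp_homeomorph (Homeomorph.neg ℝ)) hη (neg_nonneg.2 hy) (neg_nonneg.2 ha) ?_
    · simp_rw [hd] at h
      rw [← integral_neg_eq_self, ← integral_neg_eq_self
        (fun x => (deriv u x * Real.exp (-(η * |x|))) ^ 2)]
      convert h using 5
      · rw [abs_neg]
        ring_nf
      · rfl
      · rw [abs_neg]
        ring
    · have h1 := exp_sub_one_le_exp_mul_sub_one_div hη (-y)
      have h2 := Real.sinh_le_self_iff.2 hy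
      rw [Real.sinh_eq] at h2
      rw [abs_le]
      constructor <;> linarith [Real.add_one_le_exp y, Real.add_one_le_exp (-y)]

theorem integrable_exp_mul_mertonDensity (lam ν t : ℝ) {γ : ℝ} (hγ : 0 < γ) :
    Integrable fun y => Real.exp (t * y) *
      (lam / (√(2 * Real.pi) * γ) * Real.exp (-(y - ν) ^ 2 / (2 * γ ^ 2))) := by
  have h := (integrable_cexp_quadratic (b := ((1 / (2 * γ ^ 2) : ℝ) : ℂ))
    (by rw [Complex.ofReal_re]; positivity)
    ((t + ν / γ ^ 2 : ℝ) : ℂ) ((-ν ^ 2 / (2 * γ ^ 2) : ℝ) : ℂ)).norm.const_mul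
      (lam / (√(2 * Real.pi) * γ))
  refine h.congr (.of_forall fun y => ?_)
  simp only [Complex.norm_exp]
  rw [mul_left_comm, ← Real.exp_add]
  congr 2
  norm_cast
  field_simp
  ring

theorem integrable_jumpWeight_mul_mertonDensity {lam γ : ℝ} (ν η : ℝ) (hlam : 0 < lam)
    (hγ : 0 < γ) :
    Integrable fun y => (Real.exp (η * |y|) * |y| + |Real.exp y - 1|) *
      (lam / (√(2 * Real.pi) * γ) * Real.exp (-(y - ν) ^ 2 / (2 * γ ^ 2))) := by
  have h := integrable_exp_mul_mertonDensity lam ν (hγ := hγ)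
  refine (((h (η + 1)).add (h (-(η + 1)))).add ((h 1).add (h 0))).mono'
    (Continuous.aestronglyMeasurable (by fun_prop)) (.of_forall fun y => ?_)
  simp only [Pi.add_apply, ← add_mul]
  have hk : 0 ≤ lam / (√(2 * Real.pi) * γ) * Real.exp (-(y - ν) ^ 2 / (2 * γ ^ 2)) := by
    positivity
  rw [Real.norm_of_nonneg (by positivity)]
  refine mul_le_mul_of_nonneg_right (add_le_add ?_ ?_) hk
  · calc Real.exp (η * |y|) * |y| ≤ Real.exp (η * |y|) * Real.exp |y| :=
          mul_le_mul_of_nonneg_left (by linarith [Real.add_one_le_exp |y|]) (Real.exp_pos _).le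
      _ = Real.exp ((η + 1) * |y|) := by rw [← Real.exp_add]; ring_nf
      _ ≤ _ := by
          rcases abs_cases y with ⟨h, -⟩ | ⟨h, -⟩ <;> rw [h]
          · linarith [Real.exp_pos (-(η + 1) * y)]
          · rw [mul_neg, ← neg_mul]
            linarith [Real.exp_pos ((η + 1) * y)]
  · rw [one_mul, zero_mul, Real.exp_zero]
    exact (abs_sub _ _).trans (by simp)

theorem deriv_fst_eq_fderiv {u : ℝ → ℝ → ℝ} (hu : ContDiff ℝ 1 fun p : ℝ × ℝ => u p.1 p.2) :
    (fun x : ℝ × ℝ => deriv (fun a => u a x.2) x.1) =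
      fun x => fderiv ℝ (fun p : ℝ × ℝ => u p.1 p.2) x (1, 0) := by
  funext x
  have h1 : HasFDerivAt (fun p : ℝ × ℝ => u p.1 p.2) (fderiv ℝ (fun p : ℝ × ℝ => u p.1 p.2) x)
      (x.1, x.2) := (hu.differentiable one_ne_zero x).hasFDerivAt
  have h2 : HasDerivAt (fun a : ℝ => (a, x.2)) ((1 : ℝ), (0 : ℝ)) x.1 :=
    (hasDerivAt_id x.1).prodMk (hasDerivAt_const x.1 x.2)
  exact (h1.comp_hasDerivAt x.1 h2).deriv

theorem continuous_deriv_fst {u : ℝ → ℝ → ℝ} (hu : ContDiff ℝ 1 fun p : ℝ × ℝ => u p.1 p.2) :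
    Continuous fun x : ℝ × ℝ => deriv (fun a => u a x.2) x.1 := by
  rw [deriv_fst_eq_fderiv hu]
  exact (hu.continuous_fderiv one_ne_zero).clm_apply continuous_const

theorem hasCompactSupport_deriv_fst {u : ℝ → ℝ → ℝ}
    (hu : ContDiff ℝ 1 fun p : ℝ × ℝ => u p.1 p.2)
    (huc : HasCompactSupport fun p : ℝ × ℝ => u p.1 p.2) :
    HasCompactSupport fun x : ℝ × ℝ => deriv (fun a => u a x.2) x.1 := by
  rw [deriv_fst_eq_fderiv hu]
  exact (huc.fderiv ℝ).comp_left (g := fun L : ℝ × ℝ →L[ℝ] ℝ => L (1, 0)) (by simp)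

theorem hasCompactSupport_slice_fst {u : ℝ → ℝ → ℝ}
    (huc : HasCompactSupport fun p : ℝ × ℝ => u p.1 p.2) (b : ℝ) :
    HasCompactSupport fun a => u a b := by
  refine HasCompactSupport.intro (huc.isCompact.image continuous_fst) fun a ha => ?_
  by_contra h
  exact ha ⟨(a, b), subset_tsupport (fun p : ℝ × ℝ => u p.1 p.2) h, rfl⟩

/-- Weighted `L²` bound in the plane for the compensated jump of size `y` in the first
coordinate. -/
theorem sqrt_integral_compensated_jump_fst_le {u : ℝ → ℝ → ℝ}
    (hu : ContDiff ℝ 1 fun p : ℝ × ℝ => u p.1 p.2)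
    (huc : HasCompactSupport fun p : ℝ × ℝ => u p.1 p.2) {η : ℝ} (hη : 1 ≤ η) (η' y : ℝ)
    (hT : MemLp (fun x : ℝ × ℝ => (u (x.1 + y) x.2 - u x.1 x.2 -
      (Real.exp y - 1) * deriv (fun a => u a x.2) x.1) *
        Real.exp (-(η * |x.1| + η' * |x.2|))) 2 volume)
    (hd : MemLp (fun x : ℝ × ℝ => deriv (fun a => u a x.2) x.1 *
      Real.exp (-(η * |x.1| + η' * |x.2|))) 2 volume) :
    √(∫ x : ℝ × ℝ, ((u (x.1 + y) x.2 - u x.1 x.2 -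
      (Real.exp y - 1) * deriv (fun a => u a x.2) x.1) *
        Real.exp (-(η * |x.1| + η' * |x.2|))) ^ 2) ≤
      (Real.exp (η * |y|) * |y| + |Real.exp y - 1|) / √2 *
        √(∫ x : ℝ × ℝ, (deriv (fun a => u a x.2) x.1 *
          Real.exp (-(η * |x.1| + η' * |x.2|))) ^ 2) := by
  set c := (Real.exp (η * |y|) * |y| + |Real.exp y - 1|) / √2 with hc
  have hcy : 0 ≤ c := by positivity
  rw [← abs_of_nonneg hcy, ← sqrt_integral_const_mul_sq]
  refine Real.sqrt_le_sqrt ?_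
  have hi1 := hT.integrable_sq
  have hi2 := (hd.const_mul c).integrable_sq
  rw [Measure.volume_eq_prod] at hi1 hi2 ⊢
  rw [integral_prod_symm _ hi1, integral_prod_symm _ hi2]
  refine integral_mono hi1.integral_prod_right hi2.integral_prod_right fun b => ?_
  have hub : ContDiff ℝ 1 fun a => u a b := hu.comp (contDiff_prodMk_left b)
  have h := sqrt_integral_compensated_jump_le hub (hasCompactSupport_slice_fst huc b) hη y
  rw [← hc, ← abs_of_nonneg hcy, ← sqrt_integral_const_mul_sq,
    Real.sqrt_le_sqrt_iff (integral_nonneg fun x => sq_nonneg _)] at h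
  have h' := mul_le_mul_of_nonneg_right h (sq_nonneg (Real.exp (-(η' * |b|))))
  rw [← integral_mul_const, ← integral_mul_const] at h'
  have hW : ∀ a, Real.exp (-(η * |a| + η' * |b|)) =
      Real.exp (-(η * |a|)) * Real.exp (-(η' * |b|)) := fun a => by
    rw [← Real.exp_add]; ring_nf
  simp only [hW, ← mul_assoc] at h' ⊢
  simpa only [mul_pow] using h'

/-- Bound for the jump term in the first coordinate direction. -/
theorem abs_integral_jump_fst_le {k : ℝ → ℝ} (hk : Continuous k) (hk0 : ∀ y, 0 ≤ k y)
    (hkint : Integrable k) {η : ℝ} (hη : 1 ≤ η) (η' : ℝ)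
    (hcint : Integrable fun y => (Real.exp (η * |y|) * |y| + |Real.exp y - 1|) * k y)
    {u v : ℝ → ℝ → ℝ} (hu : ContDiff ℝ 1 fun p : ℝ × ℝ => u p.1 p.2)
    (huc : HasCompactSupport fun p : ℝ × ℝ => u p.1 p.2)
    (hv : Continuous fun p : ℝ × ℝ => v p.1 p.2)
    (hvc : HasCompactSupport fun p : ℝ × ℝ => v p.1 p.2) :
    Integrable (fun x : ℝ × ℝ =>
        (∫ y, (u (x.1 + y) x.2 - u x.1 x.2 -
          (Real.exp y - 1) * deriv (fun a => u a x.2) x.1) * k y) * v x.1 x.2 *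
        Real.exp (2 * -(η * |x.1| + η' * |x.2|))) ∧
    Integrable (fun x : ℝ × ℝ =>
        deriv (fun a => u a x.2) x.1 ^ 2 * Real.exp (2 * -(η * |x.1| + η' * |x.2|))) ∧
    |∫ x : ℝ × ℝ,
        (∫ y, (u (x.1 + y) x.2 - u x.1 x.2 -
          (Real.exp y - 1) * deriv (fun a => u a x.2) x.1) * k y) * v x.1 x.2 *
        Real.exp (2 * -(η * |x.1| + η' * |x.2|))| ≤
      (∫ y, (Real.exp (η * |y|) * |y| + |Real.exp y - 1|) * k y) / √2 *
        √(∫ x : ℝ × ℝ,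
          deriv (fun a => u a x.2) x.1 ^ 2 * Real.exp (2 * -(η * |x.1| + η' * |x.2|))) *
        √(∫ x : ℝ × ℝ, v x.1 x.2 ^ 2 * Real.exp (2 * -(η * |x.1| + η' * |x.2|))) := by
  set U : ℝ × ℝ → ℝ := fun p => u p.1 p.2 with hU
  set V : ℝ × ℝ → ℝ := fun p => v p.1 p.2 with hV
  set d : ℝ × ℝ → ℝ := fun x => deriv (fun a => u a x.2) x.1 with hd
  set W : ℝ × ℝ → ℝ := fun x => Real.exp (-(η * |x.1| + η' * |x.2|)) with hW
  have hWsq : ∀ x : ℝ × ℝ, Real.exp (2 * -(η * |x.1| + η' * |x.2|)) = W x ^ 2 := fun x => by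
    rw [hW, ← Real.exp_nat_mul]; norm_num
  have hWc : Continuous W := by fun_prop
  have hUc : Continuous U := hu.continuous
  have hdc : Continuous d := continuous_deriv_fst hu
  have hdsupp : HasCompactSupport d := hasCompactSupport_deriv_fst hu huc
  set T : ℝ × ℝ → ℝ → ℝ := fun x y => U (x.1 + y, x.2) - U x - (Real.exp y - 1) * d x with hT
  have hTc : Continuous T.uncurry := by fun_prop
  have hTsupp : ∀ y, HasCompactSupport fun x => T x y := by
    intro y
    have h1 : HasCompactSupport fun x : ℝ × ℝ => U (x.1 + y, x.2) := by
      have := huc.comp_homeomorph (Homeomorph.addRight ((y, 0) : ℝ × ℝ))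
      convert this using 2 with x
      simp [hU]
    exact (h1.sub huc).sub hdsupp.mul_left
  have hdW : MemLp (fun x => d x * W x) 2 volume :=
    (hdc.mul hWc).memLp_of_hasCompactSupport hdsupp.mul_right
  have hVW : MemLp (fun x => V x * W x) 2 volume :=
    (hv.mul hWc).memLp_of_hasCompactSupport hvc.mul_right
  have hTy : ∀ y, Continuous fun x => T x y := fun y => by fun_prop
  have hTW : ∀ y, MemLp (fun x => T x y * W x) 2 volume := fun y =>
    ((hTy y).mul hWc).memLp_of_hasCompactSupport (hTsupp y).mul_right
  set c : ℝ → ℝ := fun y => Real.exp (η * |y|) * |y| + |Real.exp y - 1| with hc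
  have hc0 : ∀ y, 0 ≤ c y := fun y => by positivity
  have hslice : ∀ y, √(∫ x, (T x y * W x) ^ 2) ≤ c y / √2 * √(∫ x, (d x * W x) ^ 2) := fun y =>
    sqrt_integral_compensated_jump_fst_le hu huc hη η' y (hTW y) hdW
  obtain ⟨M, hM⟩ := huc.exists_bound_of_continuous hUc
  obtain ⟨M', hM'⟩ := hdsupp.exists_bound_of_continuous hdc
  set H : (ℝ × ℝ) → ℝ → ℝ := fun x y => T x y * k y * V x * W x ^ 2 with hH
  have hcomp : Integrable fun y => |Real.exp y - 1| * k y := by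
    refine hcint.mono' (Continuous.aestronglyMeasurable (by fun_prop)) (.of_forall fun y => ?_)
    rw [Real.norm_of_nonneg (mul_nonneg (abs_nonneg _) (hk0 y))]
    exact mul_le_mul_of_nonneg_right (le_add_of_nonneg_left (by positivity)) (hk0 y)
  have hHint : Integrable H.uncurry (volume.prod volume) := by
    have hVint : Integrable fun x => |V x| * W x ^ 2 :=
      Continuous.integrable_of_hasCompactSupport (by fun_prop)
        (HasCompactSupport.mul_right (hvc.comp_left (g := fun z => |z|) abs_zero))
    have hdom := hVint.mul_prod ((hkint.const_mul (2 * M)).add (hcomp.const_mul M'))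
    refine hdom.mono' (Continuous.aestronglyMeasurable (by fun_prop)) (.of_forall ?_)
    rintro ⟨x, y⟩
    have hTle : |T x y| ≤ 2 * M + M' * |Real.exp y - 1| := by
      have h1 := hM (x.1 + y, x.2)
      have h2 := hM x
      have h3 := mul_le_mul_of_nonneg_left (hM' x) (abs_nonneg (Real.exp y - 1))
      rw [Real.norm_eq_abs] at h1 h2 h3
      calc |T x y| ≤ |U (x.1 + y, x.2)| + |U x| + |(Real.exp y - 1) * d x| :=
            (abs_sub _ _).trans (add_le_add_left (abs_sub _ _) _)
        _ ≤ _ := by rw [abs_mul]; linarith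
    simp only [hH, Function.uncurry, Real.norm_eq_abs, abs_mul, abs_of_nonneg (hk0 y), Pi.add_apply,
      abs_of_nonneg (sq_nonneg (W x))]
    calc |T x y| * k y * |V x| * W x ^ 2 = |T x y| * (k y * (|V x| * W x ^ 2)) := by ring
      _ ≤ (2 * M + M' * |Real.exp y - 1|) * (k y * (|V x| * W x ^ 2)) :=
          mul_le_mul_of_nonneg_right hTle
            (mul_nonneg (hk0 y) (mul_nonneg (abs_nonneg _) (by positivity)))
      _ = _ := by ring
  have hinner : ∀ x : ℝ × ℝ, (∫ y, (u (x.1 + y) x.2 - u x.1 x.2 -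
      (Real.exp y - 1) * deriv (fun a => u a x.2) x.1) * k y) * v x.1 x.2 * Real.exp (2 * -(η * |x.1| + η' * |x.2|)) = ∫ y, H x y := by
    intro x
    rw [hWsq, mul_assoc, ← integral_mul_const]
    refine integral_congr_ae (.of_forall fun y => ?_)
    simp only [hH, hT, hU, hV, hd]
    ring
  simp_rw [hinner, hWsq, ← mul_pow]
  refine ⟨hHint.integral_prod_left, hdW.integrable_sq, ?_⟩
  rw [integral_integral_swap hHint]
  refine abs_integral_le_integral_abs.trans ?_
  calc ∫ y, |∫ x, H x y| ≤ ∫ y, c y * k y *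
        (1 / √2 * √(∫ x, (d x * W x) ^ 2) * √(∫ x, (V x * W x) ^ 2)) := by
        refine integral_mono_of_nonneg (.of_forall fun y => abs_nonneg _)
          (hcint.mul_const _) (.of_forall fun y => ?_)
        have h1 : ∫ x, H x y = k y * ∫ x, (T x y * W x) * (V x * W x) := by
          rw [← integral_const_mul]
          congr 1
          funext x
          simp only [hH]
          ring
        have h2 := (abs_integral_mul_le_sqrt_mul_sqrt (hTW y) hVW).trans
          (mul_le_mul_of_nonneg_right (hslice y) (Real.sqrt_nonneg _))
        simp only [h1]
        rw [abs_mul, abs_of_nonneg (hk0 y)]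
        refine (mul_le_mul_of_nonneg_left h2 (hk0 y)).trans_eq ?_
        ring
    _ = _ := by rw [integral_mul_const]; ring

/-- Continuity bound for the jump part of the weighted bilinear form:
    |∫ J[u] v e^{2η}| ≤ max(c₁,c₂) ‖∇u‖_{L²_η} ‖v‖_{L²_η}. -/
theorem stmt_17 (σ₁ σ₂ : ℝ) (hσ₁ : 0 < σ₁) (hσ₂ : 0 < σ₂) (r : ℝ)
    (ρ : ℝ) (hρ : |ρ| < 1)
    (lam₁ lam₂ γ₁ γ₂ ν₁ ν₂ : ℝ)
    (hlam₁ : 0 < lam₁) (hlam₂ : 0 < lam₂) (hγ₁ : 0 < γ₁) (hγ₂ : 0 < γ₂)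
    (η₁ η₂ : ℝ) (hη₁ : 1 < η₁) (hη₂ : 1 < η₂) :
    let k₁ : ℝ → ℝ := fun y =>
      lam₁ / (Real.sqrt (2 * Real.pi) * γ₁) * Real.exp (-(y - ν₁) ^ 2 / (2 * γ₁ ^ 2))
    let k₂ : ℝ → ℝ := fun y =>
      lam₂ / (Real.sqrt (2 * Real.pi) * γ₂) * Real.exp (-(y - ν₂) ^ 2 / (2 * γ₂ ^ 2))
    let η : ℝ × ℝ → ℝ := fun x => -(η₁ * |x.1| + η₂ * |x.2|)
    let c₁ : ℝ := ∫ y : ℝ, (Real.exp (η₁ * |y|) * |y| + |Real.exp y - 1|) * k₁ y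
    let c₂ : ℝ := ∫ y : ℝ, (Real.exp (η₂ * |y|) * |y| + |Real.exp y - 1|) * k₂ y
    ∀ u v : ℝ → ℝ → ℝ,
      ContDiff ℝ 1 (fun p : ℝ × ℝ => u p.1 p.2) →
      HasCompactSupport (fun p : ℝ × ℝ => u p.1 p.2) →
      ContDiff ℝ 1 (fun p : ℝ × ℝ => v p.1 p.2) →
      HasCompactSupport (fun p : ℝ × ℝ => v p.1 p.2) →
      let J : ℝ × ℝ → ℝ := fun x =>
        (∫ y : ℝ,
          (u (x.1 + y) x.2 - u x.1 x.2 -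
            (Real.exp y - 1) * deriv (fun a => u a x.2) x.1) * k₁ y) +
        (∫ y : ℝ,
          (u x.1 (x.2 + y) - u x.1 x.2 -
            (Real.exp y - 1) * deriv (fun b => u x.1 b) x.2) * k₂ y)
      |∫ x : ℝ × ℝ, J x * v x.1 x.2 * Real.exp (2 * η x)| ≤
        max c₁ c₂ *
          Real.sqrt (∫ x : ℝ × ℝ,
            ((deriv (fun a => u a x.2) x.1) ^ 2 +
              (deriv (fun b => u x.1 b) x.2) ^ 2) * Real.exp (2 * η x)) *
          Real.sqrt (∫ x : ℝ × ℝ, (v x.1 x.2) ^ 2 * Real.exp (2 * η x)) := by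
  intro k₁ k₂ η c₁ c₂ u v hu huc hv hvc J
  have hk₁ := integrable_exp_mul_mertonDensity lam₁ ν₁ 0 hγ₁
  have hk₂ := integrable_exp_mul_mertonDensity lam₂ ν₂ 0 hγ₂
  simp only [zero_mul, Real.exp_zero, one_mul] at hk₁ hk₂
  have hk₁0 : ∀ y, 0 ≤ k₁ y := fun y => by positivity
  have hk₂0 : ∀ y, 0 ≤ k₂ y := fun y => by positivity
  obtain ⟨hI₁, hG₁, hB₁⟩ := abs_integral_jump_fst_le (k := k₁) (by fun_prop) hk₁0 hk₁ hη₁.le η₂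
    (integrable_jumpWeight_mul_mertonDensity ν₁ η₁ hlam₁ hγ₁) hu huc hv.continuous hvc
  obtain ⟨hI₂, hG₂, hB₂⟩ := abs_integral_jump_fst_le (k := k₂) (by fun_prop) hk₂0 hk₂ hη₂.le η₁
    (integrable_jumpWeight_mul_mertonDensity ν₂ η₂ hlam₂ hγ₂)
    (u := fun a b => u b a) (v := fun a b => v b a)
    (hu.comp (contDiff_snd.prodMk contDiff_fst))
    (huc.comp_homeomorph (Homeomorph.prodComm ℝ ℝ))
    (hv.continuous.comp continuous_swap)
    (hvc.comp_homeomorph (Homeomorph.prodComm ℝ ℝ))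
  rw [Measure.volume_eq_prod] at hI₂ hG₂ hB₂
  rw [← integral_prod_swap, ← integral_prod_swap (f := fun x : ℝ × ℝ =>
      deriv (fun a => u x.2 a) x.1 ^ 2 * Real.exp (2 * -(η₂ * |x.1| + η₁ * |x.2|))),
    ← integral_prod_swap (f := fun x : ℝ × ℝ =>
      v x.2 x.1 ^ 2 * Real.exp (2 * -(η₂ * |x.1| + η₁ * |x.2|)))] at hB₂
  have hI₂' := hI₂.swap
  have hG₂' := hG₂.swap
  rw [← Measure.volume_eq_prod] at hI₂' hG₂' hB₂
  have hη : ∀ x : ℝ × ℝ, -(η₂ * |x.2| + η₁ * |x.1|) = η x := fun x => by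
    simp only [η]; ring
  simp only [Function.comp_def, Prod.fst_swap, Prod.snd_swap, hη] at hI₂' hG₂' hB₂
  set A := ∫ x : ℝ × ℝ, deriv (fun a => u a x.2) x.1 ^ 2 * Real.exp (2 * η x) with hA
  set B := ∫ x : ℝ × ℝ, deriv (fun b => u x.1 b) x.2 ^ 2 * Real.exp (2 * η x) with hB
  set N := √(∫ x : ℝ × ℝ, v x.1 x.2 ^ 2 * Real.exp (2 * η x)) with hN
  have hA0 : 0 ≤ A := integral_nonneg fun x => by positivity
  have hB0 : 0 ≤ B := integral_nonneg fun x => by positivity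
  have hgrad : ∫ x : ℝ × ℝ, ((deriv (fun a => u a x.2) x.1) ^ 2 +
      (deriv (fun b => u x.1 b) x.2) ^ 2) * Real.exp (2 * η x) = A + B := by
    simp_rw [add_mul]
    exact integral_add hG₁ hG₂'
  have hJ : |∫ x : ℝ × ℝ, J x * v x.1 x.2 * Real.exp (2 * η x)| ≤
      c₁ / √2 * √A * N + c₂ / √2 * √B * N := by
    refine le_of_eq_of_le (congrArg abs ?_) ((abs_add_le _ _).trans (add_le_add hB₁ hB₂))
    rw [← integral_add hI₁ hI₂']
    refine integral_congr_ae (.of_forall fun x => ?_)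
    simp only [J, η]
    ring
  rw [hgrad]
  have hsum : √A + √B ≤ √2 * √(A + B) := by
    rw [← Real.sqrt_mul two_pos.le]
    refine Real.le_sqrt_of_sq_le ?_
    nlinarith [Real.sq_sqrt hA0, Real.sq_sqrt hB0, sq_nonneg (√A - √B)]
  have hm0 : 0 ≤ max c₁ c₂ := le_max_of_le_left <| integral_nonneg fun y =>
    mul_nonneg (by positivity) (hk₁0 y)
  calc _ ≤ c₁ / √2 * √A * N + c₂ / √2 * √B * N := hJ
    _ ≤ max c₁ c₂ / √2 * √A * N + max c₁ c₂ / √2 * √B * N := by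
        gcongr
        · exact le_max_left _ _
        · exact le_max_right _ _
    _ = max c₁ c₂ / √2 * (√A + √B) * N := by ring
    _ ≤ max c₁ c₂ / √2 * (√2 * √(A + B)) * N := by gcongr
    _ = _ := by field_simp
end

section
/- Fix σ₁, σ₂ > 0, r ∈ ℝ and ρ with |ρ| < 1, let κ = (1/2)·[[σ₁², ρσ₁σ₂],[ρσ₁σ₂, σ₂²]], α = (r − σ₁²/2, r − σ₂²/2), fix Merton densities k₁, k₂, weight parameters η₁, η₂ > 1 and the weight η(x) = −(η₁|x₁| + η₂|x₂|). Then there exists a constant c̄ > 0 such that for all smooth compactly supported u, v : ℝ² → ℝ, |a^η(u, v)| ≤ c̄ · ‖u‖_{H¹_η} · ‖v‖_{H¹_η}, where ‖w‖²_{H¹_η} = ∫_{ℝ²} (w² + |∇w|²) e^{2η(x)} dx. -/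
open MeasureTheory

/-- The Cauchy–Schwarz inequality with a continuous nonnegative weight. -/
theorem integral_mul_mul_le_sqrt_mul_sqrt {E : Type*} [TopologicalSpace E] [MeasurableSpace E]
    [OpensMeasurableSpace E] {μ : Measure E} [IsFiniteMeasureOnCompacts μ] {f g W : E → ℝ}
    (hf : Continuous f) (hfc : HasCompactSupport f) (hf0 : ∀ x, 0 ≤ f x)
    (hg : Continuous g) (hgc : HasCompactSupport g) (hg0 : ∀ x, 0 ≤ g x)
    (hW : Continuous W) (hW0 : ∀ x, 0 ≤ W x) :
    ∫ x, f x * g x * W x ∂μ ≤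
      Real.sqrt (∫ x, f x ^ 2 * W x ∂μ) * Real.sqrt (∫ x, g x ^ 2 * W x ∂μ) := by
  have hs : Continuous fun x => Real.sqrt (W x) := hW.sqrt
  have hLp : ∀ h : E → ℝ, Continuous h → HasCompactSupport h →
      MemLp (fun x => h x * Real.sqrt (W x)) (ENNReal.ofReal 2) μ := fun h hh hhc =>
    (hh.mul hs).memLp_of_hasCompactSupport hhc.mul_right
  have key := integral_mul_le_Lp_mul_Lq_of_nonneg (μ := μ) Real.HolderConjugate.two_two
    (.of_forall fun x => mul_nonneg (hf0 x) (Real.sqrt_nonneg (W x)))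
    (.of_forall fun x => mul_nonneg (hg0 x) (Real.sqrt_nonneg (W x)))
    (hLp f hf hfc) (hLp g hg hgc)
  simp only [Real.rpow_two, mul_pow, Real.sq_sqrt (hW0 _), ← Real.sqrt_eq_rpow] at key
  refine le_of_eq_of_le (integral_congr_ae (.of_forall fun x => ?_)) key
  simp only
  rw [mul_mul_mul_comm, Real.mul_self_sqrt (hW0 x)]

section Shift

variable {E : Type*} [NormedAddCommGroup E] [NormedSpace ℝ E]
  [MeasurableSpace E] [BorelSpace E] {μ : Measure E} [μ.IsAddHaarMeasure]

/-- Translating a function by `y • e` costs at most a factor `exp (c * |y|)` in the weighted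
`L²` norm. -/
theorem integral_shift_mul_mul_le {f g W : E → ℝ} {e : E} {c : ℝ} (hc : 0 ≤ c)
    (hf : Continuous f) (hfc : HasCompactSupport f) (hf0 : ∀ x, 0 ≤ f x)
    (hg : Continuous g) (hgc : HasCompactSupport g) (hg0 : ∀ x, 0 ≤ g x)
    (hW : Continuous W) (hW0 : ∀ x, 0 ≤ W x)
    (hshift : ∀ x y, W x ≤ Real.exp (c * |y|) * W (x + y • e)) (y : ℝ) :
    ∫ x, f (x + y • e) * g x * W x ∂μ ≤ Real.exp (c * |y|) *
      (Real.sqrt (∫ x, f x ^ 2 * W x ∂μ) * Real.sqrt (∫ x, g x ^ 2 * W x ∂μ)) := by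
  have hft : Continuous fun x => f (x + y • e) := by fun_prop
  have hftc : HasCompactSupport fun x => f (x + y • e) :=
    hfc.comp_homeomorph (Homeomorph.addRight (y • e))
  have hsq : ∀ h : E → ℝ, Continuous h → HasCompactSupport h → ∀ V : E → ℝ, Continuous V →
      Integrable (fun x => h x ^ 2 * V x) μ := fun h hh hhc V hV => by
    have hsupp : HasCompactSupport fun x => h x ^ 2 :=
      hhc.comp_left (g := fun t : ℝ => t ^ 2) (by simp)
    have hcont : Continuous fun x => h x ^ 2 * V x := by fun_prop
    exact hcont.integrable_of_hasCompactSupport hsupp.mul_right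
  refine (integral_mul_mul_le_sqrt_mul_sqrt hft hftc (fun x => hf0 _) hg hgc hg0 hW hW0).trans ?_
  rw [← mul_assoc]
  refine mul_le_mul_of_nonneg_right ?_ (Real.sqrt_nonneg _)
  have hbound : ∫ x, f (x + y • e) ^ 2 * W x ∂μ ≤
      Real.exp (c * |y|) * ∫ x, f x ^ 2 * W x ∂μ := by
    rw [← integral_add_right_eq_self (fun x => f x ^ 2 * W x) (y • e), ← integral_const_mul]
    refine integral_mono (hsq _ hft hftc W hW)
      ((hsq _ hft hftc (fun x => W (x + y • e)) (by fun_prop)).const_mul _) fun x => ?_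
    calc f (x + y • e) ^ 2 * W x ≤ f (x + y • e) ^ 2 * (Real.exp (c * |y|) * W (x + y • e)) :=
          mul_le_mul_of_nonneg_left (hshift x y) (sq_nonneg _)
      _ = _ := by ring
  have hone : 1 ≤ Real.exp (c * |y|) := Real.one_le_exp (by positivity)
  calc Real.sqrt (∫ x, f (x + y • e) ^ 2 * W x ∂μ)
      ≤ Real.sqrt (Real.exp (c * |y|) * ∫ x, f x ^ 2 * W x ∂μ) := Real.sqrt_le_sqrt hbound
    _ = Real.sqrt (Real.exp (c * |y|)) * Real.sqrt (∫ x, f x ^ 2 * W x ∂μ) :=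
        Real.sqrt_mul (Real.exp_pos _).le _
    _ ≤ Real.exp (c * |y|) * Real.sqrt (∫ x, f x ^ 2 * W x ∂μ) := mul_le_mul_of_nonneg_right
        (Real.sqrt_le_iff.2 ⟨(Real.exp_pos _).le, le_self_pow₀ hone two_ne_zero⟩) (Real.sqrt_nonneg _)

/-- A kernel with exponential moments acts boundedly, by convolution along `e`, on the weighted
`L²` space. -/
theorem integrable_and_integral_convolution_mul_mul_le [FiniteDimensional ℝ E]
    {f g W : E → ℝ} {e : E} {c : ℝ} (hc : 0 ≤ c)
    {k : ℝ → ℝ} (hk0 : ∀ y, 0 ≤ k y) (hk : Integrable k)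
    (hkc : Integrable fun y => Real.exp (c * |y|) * k y)
    (hf : Continuous f) (hfc : HasCompactSupport f) (hf0 : ∀ x, 0 ≤ f x)
    (hg : Continuous g) (hgc : HasCompactSupport g) (hg0 : ∀ x, 0 ≤ g x)
    (hW : Continuous W) (hW0 : ∀ x, 0 ≤ W x)
    (hshift : ∀ x y, W x ≤ Real.exp (c * |y|) * W (x + y • e)) :
    Integrable (fun x => (∫ y, f (x + y • e) * k y) * g x * W x) μ ∧
    ∫ x, (∫ y, f (x + y • e) * k y) * g x * W x ∂μ ≤ (∫ y, Real.exp (c * |y|) * k y) *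
      (Real.sqrt (∫ x, f x ^ 2 * W x ∂μ) * Real.sqrt (∫ x, g x ^ 2 * W x ∂μ)) := by
  have hgW : Integrable (fun x => g x * W x) μ :=
    (hg.mul hW).integrable_of_hasCompactSupport hgc.mul_right
  obtain ⟨M, hM⟩ := hfc.exists_bound_of_continuous hf
  have hF : Integrable (fun p : E × ℝ => f (p.1 + p.2 • e) * (g p.1 * W p.1 * k p.2))
      (μ.prod volume) :=
    (hgW.mul_prod hk).bdd_mul (c := M)
      (by fun_prop : Continuous fun p : E × ℝ => f (p.1 + p.2 • e)).aestronglyMeasurable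
      (.of_forall fun p => hM _)
  have hpull : ∀ x, ∫ y, f (x + y • e) * (g x * W x * k y) =
      (∫ y, f (x + y • e) * k y) * g x * W x := fun x => by
    rw [mul_assoc, ← integral_mul_const]
    exact integral_congr_ae (.of_forall fun y => by ring)
  have hpull' : ∀ y, ∫ x, f (x + y • e) * (g x * W x * k y) ∂μ =
      (∫ x, f (x + y • e) * g x * W x ∂μ) * k y := fun y => by
    rw [← integral_mul_const]
    exact integral_congr_ae (.of_forall fun y => by ring)
  refine ⟨by simpa only [hpull] using hF.integral_prod_left, ?_⟩
  have hswap := integral_integral_swap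
    (f := fun x y => f (x + y • e) * (g x * W x * k y)) hF
  simp only [hpull, hpull'] at hswap
  rw [hswap, ← integral_mul_const]
  refine integral_mono (by simpa only [hpull'] using hF.integral_prod_right)
    (hkc.mul_const _) fun y => ?_
  refine (mul_le_mul_of_nonneg_right (integral_shift_mul_mul_le hc hf hfc hf0 hg hgc hg0 hW hW0
    hshift y) (hk0 y)).trans_eq ?_
  ring

end Shift

/-- The compensated jump integral is controlled by the convolution of `N` with the kernel and
the value of `N` at the base point. -/
theorem abs_integral_jump_le {φ N : ℝ → ℝ} {a d n : ℝ} {k : ℝ → ℝ} (hk0 : ∀ y, 0 ≤ k y)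
    (hk : Integrable k) (hk1 : Integrable fun y => Real.exp (1 * |y|) * k y)
    (hN : Integrable fun y => N y * k y)
    (hφ : ∀ y, |φ y| ≤ N y) (ha : |a| ≤ n) (hd : |d| ≤ n) :
    |∫ y, (φ y - a - (Real.exp y - 1) * d) * k y| ≤
      (∫ y, N y * k y) + (∫ y, (2 * k y + Real.exp (1 * |y|) * k y)) * n := by
  have hI : Integrable fun y => 2 * k y + Real.exp (1 * |y|) * k y := (hk.const_mul 2).add hk1
  rw [← integral_mul_const, ← integral_add hN (hI.mul_const n), ← Real.norm_eq_abs]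
  refine norm_integral_le_of_norm_le (hN.add (hI.mul_const n)) (.of_forall fun y => ?_)
  have he : |Real.exp y - 1| ≤ Real.exp |y| + 1 := by
    refine (abs_sub _ _).trans ?_
    rw [Real.abs_exp, abs_one]
    gcongr
    exact le_abs_self y
  have hb : |φ y - a - (Real.exp y - 1) * d| ≤ N y + n + (Real.exp |y| + 1) * n := by
    refine (abs_sub _ _).trans (add_le_add ((abs_sub _ _).trans (add_le_add (hφ y) ha)) ?_)
    rw [abs_mul]
    exact mul_le_mul he hd (abs_nonneg _) (by positivity)
  rw [Real.norm_eq_abs, abs_mul, abs_of_nonneg (hk0 y), one_mul]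
  refine (mul_le_mul_of_nonneg_right hb (hk0 y)).trans_eq ?_
  ring

/-- Gaussian densities have exponential moments of every order. -/
theorem integrable_exp_mul_abs_mul_gaussian (A ν c : ℝ) {γ : ℝ} (hγ : 0 < γ) :
    Integrable fun y : ℝ =>
      Real.exp (c * |y|) * (A * Real.exp (-(y - ν) ^ 2 / (2 * γ ^ 2))) := by
  set b : ℝ := 1 / (2 * γ ^ 2) with hb
  have hb0 : 0 < b := by positivity
  refine ((integrable_exp_neg_mul_sq (b := b / 4) (by positivity)).const_mul
    (|A| * Real.exp (b * ν ^ 2 + c ^ 2 / b))).mono'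
    (by fun_prop : Continuous _).aestronglyMeasurable (.of_forall fun y => ?_)
  have hexp : c * |y| + -(y - ν) ^ 2 / (2 * γ ^ 2) ≤ b * ν ^ 2 + c ^ 2 / b + -(b / 4) * y ^ 2 := by
    have h1 : -(y - ν) ^ 2 / (2 * γ ^ 2) = -b * (y - ν) ^ 2 := by rw [hb]; ring
    have h2 : c * |y| ≤ c ^ 2 / b + b / 4 * y ^ 2 := by
      have h3 : c ^ 2 / b + b / 4 * y ^ 2 - c * |y| = b * (c / b - |y| / 2) ^ 2 := by
        rw [← sq_abs y]; field_simp; ring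
      nlinarith [mul_nonneg hb0.le (sq_nonneg (c / b - |y| / 2))]
    rw [h1]
    nlinarith [mul_nonneg hb0.le (sq_nonneg (y - 2 * ν))]
  rw [Real.norm_eq_abs, abs_mul, abs_mul, Real.abs_exp, Real.abs_exp, mul_left_comm, mul_assoc,
    ← Real.exp_add, ← Real.exp_add]
  gcongr

/-- The pointwise norm `√(w² + |∇w|²)` of a smooth compactly supported function is continuous and
compactly supported. -/
theorem continuous_and_hasCompactSupport_sqrt_sq_add {w : ℝ → ℝ → ℝ}
    (hw : ContDiff ℝ (⊤ : ℕ∞) (fun p : ℝ × ℝ => w p.1 p.2))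
    (hwc : HasCompactSupport (fun p : ℝ × ℝ => w p.1 p.2)) :
    Continuous (fun x : ℝ × ℝ => Real.sqrt (w x.1 x.2 ^ 2 +
      deriv (fun a => w a x.2) x.1 ^ 2 + deriv (fun b => w x.1 b) x.2 ^ 2)) ∧
    HasCompactSupport (fun x : ℝ × ℝ => Real.sqrt (w x.1 x.2 ^ 2 +
      deriv (fun a => w a x.2) x.1 ^ 2 + deriv (fun b => w x.1 b) x.2 ^ 2)) := by
  have hdiff : Differentiable ℝ (fun p : ℝ × ℝ => w p.1 p.2) := hw.differentiable (by simp)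
  have h1 : ∀ x : ℝ × ℝ, deriv (fun a => w a x.2) x.1 =
      fderiv ℝ (fun p : ℝ × ℝ => w p.1 p.2) x (1, 0) := fun x =>
    ((hdiff x).hasFDerivAt.comp_hasDerivAt (f := fun a => (a, x.2)) x.1
      ((hasDerivAt_id x.1).prodMk (hasDerivAt_const x.1 x.2))).deriv
  have h2 : ∀ x : ℝ × ℝ, deriv (fun b => w x.1 b) x.2 =
      fderiv ℝ (fun p : ℝ × ℝ => w p.1 p.2) x (0, 1) := fun x =>
    ((hdiff x).hasFDerivAt.comp_hasDerivAt (f := fun b => (x.1, b)) x.2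
      ((hasDerivAt_const x.2 x.1).prodMk (hasDerivAt_id x.2))).deriv
  have hfd : Continuous (fderiv ℝ (fun p : ℝ × ℝ => w p.1 p.2)) := hw.continuous_fderiv (by simp)
  have hcont := hw.continuous
  have hsq : ∀ h : ℝ × ℝ → ℝ, HasCompactSupport h → HasCompactSupport fun x => h x ^ 2 :=
    fun h hh => hh.comp_left (g := fun t : ℝ => t ^ 2) (by simp)
  simp only [h1, h2]
  refine ⟨by fun_prop, HasCompactSupport.comp_left (g := Real.sqrt) ?_ Real.sqrt_zero⟩
  exact ((hsq _ hwc).add (hsq _ (hwc.fderiv_apply ℝ (1, 0)))).add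
    (hsq _ (hwc.fderiv_apply ℝ (0, 1)))

/-- Continuity of the weighted bilinear form a^η (Proposition 3.1, part 1):
    |a^η(u,v)| ≤ c̄ ‖u‖_{H¹_η} ‖v‖_{H¹_η} for smooth compactly supported u, v. -/
theorem stmt_18 (σ₁ σ₂ : ℝ) (hσ₁ : 0 < σ₁) (hσ₂ : 0 < σ₂) (r : ℝ)
    (ρ : ℝ) (hρ : |ρ| < 1)
    (lam₁ lam₂ γ₁ γ₂ ν₁ ν₂ : ℝ)
    (hlam₁ : 0 < lam₁) (hlam₂ : 0 < lam₂) (hγ₁ : 0 < γ₁) (hγ₂ : 0 < γ₂)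
    (η₁ η₂ : ℝ) (hη₁ : 1 < η₁) (hη₂ : 1 < η₂) :
    let k₁ : ℝ → ℝ := fun y =>
      lam₁ / (Real.sqrt (2 * Real.pi) * γ₁) * Real.exp (-(y - ν₁) ^ 2 / (2 * γ₁ ^ 2))
    let k₂ : ℝ → ℝ := fun y =>
      lam₂ / (Real.sqrt (2 * Real.pi) * γ₂) * Real.exp (-(y - ν₂) ^ 2 / (2 * γ₂ ^ 2))
    let η : ℝ × ℝ → ℝ := fun x => -(η₁ * |x.1| + η₂ * |x.2|)
    -- partial derivatives
    let d₁ : (ℝ → ℝ → ℝ) → ℝ × ℝ → ℝ := fun w x => deriv (fun a => w a x.2) x.1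
    let d₂ : (ℝ → ℝ → ℝ) → ℝ × ℝ → ℝ := fun w x => deriv (fun b => w x.1 b) x.2
    -- components of κ ∇η(x), with ∇η(x) = (−η₁ sgn x₁, −η₂ sgn x₂)
    let K₁ : ℝ × ℝ → ℝ := fun x =>
      (1 / 2) * (σ₁ ^ 2 * (-(η₁ * Real.sign x.1)) + ρ * σ₁ * σ₂ * (-(η₂ * Real.sign x.2)))
    let K₂ : ℝ × ℝ → ℝ := fun x =>
      (1 / 2) * (ρ * σ₁ * σ₂ * (-(η₁ * Real.sign x.1)) + σ₂ ^ 2 * (-(η₂ * Real.sign x.2)))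
    -- jump operator
    let J : (ℝ → ℝ → ℝ) → ℝ × ℝ → ℝ := fun u x =>
      (∫ y : ℝ,
        (u (x.1 + y) x.2 - u x.1 x.2 - (Real.exp y - 1) * d₁ u x) * k₁ y) +
      (∫ y : ℝ,
        (u x.1 (x.2 + y) - u x.1 x.2 - (Real.exp y - 1) * d₂ u x) * k₂ y)
    -- weighted bilinear form
    let aη : (ℝ → ℝ → ℝ) → (ℝ → ℝ → ℝ) → ℝ := fun u v =>
      (∫ x : ℝ × ℝ,
        ((1 / 2) * (σ₁ ^ 2 * d₁ u x * d₁ v x +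
            ρ * σ₁ * σ₂ * (d₁ u x * d₂ v x + d₂ u x * d₁ v x) +
            σ₂ ^ 2 * d₂ u x * d₂ v x) -
          (((r - σ₁ ^ 2 / 2) + K₁ x) * d₁ u x +
            ((r - σ₂ ^ 2 / 2) + K₂ x) * d₂ u x) * v x.1 x.2) *
          Real.exp (2 * η x)) -
      ∫ x : ℝ × ℝ, J u x * v x.1 x.2 * Real.exp (2 * η x)
    -- squared weighted H¹ norm
    let H1sq : (ℝ → ℝ → ℝ) → ℝ := fun w =>
      ∫ x : ℝ × ℝ,
        ((w x.1 x.2) ^ 2 + (d₁ w x) ^ 2 + (d₂ w x) ^ 2) * Real.exp (2 * η x)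
    ∃ cbar : ℝ, 0 < cbar ∧
      ∀ u v : ℝ → ℝ → ℝ,
        ContDiff ℝ (⊤ : ℕ∞) (fun p : ℝ × ℝ => u p.1 p.2) →
        HasCompactSupport (fun p : ℝ × ℝ => u p.1 p.2) →
        ContDiff ℝ (⊤ : ℕ∞) (fun p : ℝ × ℝ => v p.1 p.2) →
        HasCompactSupport (fun p : ℝ × ℝ => v p.1 p.2) →
        |aη u v| ≤ cbar * Real.sqrt (H1sq u) * Real.sqrt (H1sq v) := by
  intro k₁ k₂ η d₁ d₂ K₁ K₂ J aη H1sq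
  have hk₁0 : ∀ y, 0 ≤ k₁ y := fun y => by positivity
  have hk₂0 : ∀ y, 0 ≤ k₂ y := fun y => by positivity
  have hexp₁ : ∀ c, Integrable fun y => Real.exp (c * |y|) * k₁ y := fun c =>
    integrable_exp_mul_abs_mul_gaussian _ _ c hγ₁
  have hexp₂ : ∀ c, Integrable fun y => Real.exp (c * |y|) * k₂ y := fun c =>
    integrable_exp_mul_abs_mul_gaussian _ _ c hγ₂
  have hk₁ : Integrable k₁ := by simpa using hexp₁ 0
  have hk₂ : Integrable k₂ := by simpa using hexp₂ 0
  set W : ℝ × ℝ → ℝ := fun x => Real.exp (2 * η x)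
  have hW0 : ∀ x, 0 ≤ W x := fun x => (Real.exp_pos _).le
  have hW : Continuous W := by fun_prop
  have hshift₁ : ∀ (x : ℝ × ℝ) (y : ℝ),
      W x ≤ Real.exp (2 * η₁ * |y|) * W (x + y • ((1 : ℝ), (0 : ℝ))) := fun x y => by
    simp only [W, η, ← Real.exp_add, Real.exp_le_exp, Prod.fst_add, Prod.snd_add, Prod.smul_fst,
      Prod.smul_snd, smul_eq_mul, mul_one, mul_zero, add_zero]
    nlinarith [abs_add_le x.1 y]
  have hshift₂ : ∀ (x : ℝ × ℝ) (y : ℝ),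
      W x ≤ Real.exp (2 * η₂ * |y|) * W (x + y • ((0 : ℝ), (1 : ℝ))) := fun x y => by
    simp only [W, η, ← Real.exp_add, Real.exp_le_exp, Prod.fst_add, Prod.snd_add, Prod.smul_fst,
      Prod.smul_snd, smul_eq_mul, mul_one, mul_zero, add_zero]
    nlinarith [abs_add_le x.2 y]
  set L₁ : ℝ := |r - σ₁ ^ 2 / 2| + 1 / 2 * (σ₁ ^ 2 * η₁ + |ρ * σ₁ * σ₂| * η₂)
  set L₂ : ℝ := |r - σ₂ ^ 2 / 2| + 1 / 2 * (|ρ * σ₁ * σ₂| * η₁ + σ₂ ^ 2 * η₂)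
  have hsign : ∀ t : ℝ, |Real.sign t| ≤ 1 := fun t => by
    rcases Real.sign_apply_eq t with h | h | h <;> simp [h]
  have hterm : ∀ a b t : ℝ, 0 ≤ b → |a * (-(b * Real.sign t))| ≤ |a| * b := fun a b t hb => by
    rw [abs_mul, abs_neg, abs_mul, abs_of_nonneg hb]
    exact mul_le_mul_of_nonneg_left (mul_le_of_le_one_right hb (hsign t)) (abs_nonneg a)
  have hb₁ : ∀ x, |(r - σ₁ ^ 2 / 2) + K₁ x| ≤ L₁ := fun x => by
    refine (abs_add_le _ _).trans (add_le_add le_rfl ?_)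
    simp only [K₁]
    rw [abs_mul, abs_of_pos (by norm_num : (0 : ℝ) < 1 / 2)]
    refine mul_le_mul_of_nonneg_left ((abs_add_le _ _).trans (add_le_add ?_ ?_)) (by norm_num)
    · exact (hterm (σ₁ ^ 2) η₁ x.1 (by linarith)).trans_eq
        (by rw [abs_of_nonneg (sq_nonneg σ₁)])
    · exact hterm _ η₂ x.2 (by linarith)
  have hb₂ : ∀ x, |(r - σ₂ ^ 2 / 2) + K₂ x| ≤ L₂ := fun x => by
    refine (abs_add_le _ _).trans (add_le_add le_rfl ?_)
    simp only [K₂]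
    rw [abs_mul, abs_of_pos (by norm_num : (0 : ℝ) < 1 / 2)]
    refine mul_le_mul_of_nonneg_left ((abs_add_le _ _).trans (add_le_add ?_ ?_)) (by norm_num)
    · exact hterm _ η₁ x.1 (by linarith)
    · exact (hterm (σ₂ ^ 2) η₂ x.2 (by linarith)).trans_eq
        (by rw [abs_of_nonneg (sq_nonneg σ₂)])
  have hL₁0 : 0 ≤ L₁ := (abs_nonneg _).trans (hb₁ 0)
  have hL₂0 : 0 ≤ L₂ := (abs_nonneg _).trans (hb₂ 0)
  set A : ℝ := 1 / 2 * (σ₁ ^ 2 + |ρ * σ₁ * σ₂| * 2 + σ₂ ^ 2) + (L₁ + L₂) with hA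
  set M₁ : ℝ := ∫ y, (2 * k₁ y + Real.exp (1 * |y|) * k₁ y)
  set M₂ : ℝ := ∫ y, (2 * k₂ y + Real.exp (1 * |y|) * k₂ y)
  set Λ₁ : ℝ := ∫ y, Real.exp (2 * η₁ * |y|) * k₁ y
  set Λ₂ : ℝ := ∫ y, Real.exp (2 * η₂ * |y|) * k₂ y
  have hM₁0 : 0 ≤ M₁ := integral_nonneg fun y => by have := hk₁0 y; positivity
  have hM₂0 : 0 ≤ M₂ := integral_nonneg fun y => by have := hk₂0 y; positivity
  have hΛ₁0 : 0 ≤ Λ₁ := integral_nonneg fun y => by have := hk₁0 y; positivity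
  have hΛ₂0 : 0 ≤ Λ₂ := integral_nonneg fun y => by have := hk₂0 y; positivity
  refine ⟨A + (Λ₁ + Λ₂ + (M₁ + M₂)), by positivity, fun u v hu huc hv hvc => ?_⟩
  set N : (ℝ → ℝ → ℝ) → ℝ × ℝ → ℝ := fun w x =>
    Real.sqrt (w x.1 x.2 ^ 2 + d₁ w x ^ 2 + d₂ w x ^ 2)
  have hNsq : ∀ w x, N w x ^ 2 = w x.1 x.2 ^ 2 + d₁ w x ^ 2 + d₂ w x ^ 2 := fun w x =>
    Real.sq_sqrt (by positivity)
  have hN0 : ∀ w x, 0 ≤ N w x := fun w x => Real.sqrt_nonneg _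
  have hNw : ∀ w x, |w x.1 x.2| ≤ N w x := fun w x =>
    Real.abs_le_sqrt (by nlinarith [sq_nonneg (d₁ w x), sq_nonneg (d₂ w x)])
  have hN₁ : ∀ w x, |d₁ w x| ≤ N w x := fun w x =>
    Real.abs_le_sqrt (by nlinarith [sq_nonneg (w x.1 x.2), sq_nonneg (d₂ w x)])
  have hN₂ : ∀ w x, |d₂ w x| ≤ N w x := fun w x =>
    Real.abs_le_sqrt (by nlinarith [sq_nonneg (w x.1 x.2), sq_nonneg (d₁ w x)])
  obtain ⟨hNu, hNuc⟩ : Continuous (N u) ∧ HasCompactSupport (N u) :=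
    continuous_and_hasCompactSupport_sqrt_sq_add hu huc
  obtain ⟨hNv, hNvc⟩ : Continuous (N v) ∧ HasCompactSupport (N v) :=
    continuous_and_hasCompactSupport_sqrt_sq_add hv hvc
  have hH : ∀ w, H1sq w = ∫ x, N w x ^ 2 * W x := fun w => by simp only [hNsq]; rfl
  set S : ℝ := Real.sqrt (H1sq u) * Real.sqrt (H1sq v) with hS
  have hCS : ∫ x, N u x * N v x * W x ≤ S := by
    rw [hS, hH, hH]
    exact integral_mul_mul_le_sqrt_mul_sqrt hNu hNuc (hN0 u) hNv hNvc (hN0 v) hW hW0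
  have hNN : Integrable fun x => N u x * N v x * W x :=
    ((hNu.mul hNv).mul hW).integrable_of_hasCompactSupport hNuc.mul_right.mul_right
  have hmul : ∀ a b p q : ℝ, |a| ≤ p → |b| ≤ q → |a * b| ≤ p * q := fun a b p q ha hb => by
    rw [abs_mul]
    exact mul_le_mul ha hb (abs_nonneg b) ((abs_nonneg a).trans ha)
  -- the diffusion and drift part
  have hlocal : ∀ x, |(1 / 2) * (σ₁ ^ 2 * d₁ u x * d₁ v x +
      ρ * σ₁ * σ₂ * (d₁ u x * d₂ v x + d₂ u x * d₁ v x) + σ₂ ^ 2 * d₂ u x * d₂ v x) -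
      (((r - σ₁ ^ 2 / 2) + K₁ x) * d₁ u x + ((r - σ₂ ^ 2 / 2) + K₂ x) * d₂ u x) * v x.1 x.2| ≤
      A * (N u x * N v x) := fun x => by
    have hs₁ : |σ₁ ^ 2| ≤ σ₁ ^ 2 := (abs_of_nonneg (sq_nonneg _)).le
    have hs₂ : |σ₂ ^ 2| ≤ σ₂ ^ 2 := (abs_of_nonneg (sq_nonneg _)).le
    have hhalf : |(1 / 2 : ℝ)| ≤ 1 / 2 := (abs_of_pos (by norm_num)).le
    have h11 := hmul _ _ _ _ (hmul _ _ _ _ hs₁ (hN₁ u x)) (hN₁ v x)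
    have h22 := hmul _ _ _ _ (hmul _ _ _ _ hs₂ (hN₂ u x)) (hN₂ v x)
    have h12 := hmul _ _ _ _ (le_refl |ρ * σ₁ * σ₂|) ((abs_add_le _ _).trans
      (add_le_add (hmul _ _ _ _ (hN₁ u x) (hN₂ v x)) (hmul _ _ _ _ (hN₂ u x) (hN₁ v x))))
    have hdiffusion := hmul _ _ _ _ hhalf ((abs_add_le _ _).trans
      (add_le_add ((abs_add_le _ _).trans (add_le_add h11 h12)) h22))
    have hdrift := hmul _ _ _ _ ((abs_add_le _ _).trans (add_le_add
      (hmul _ _ _ _ (hb₁ x) (hN₁ u x)) (hmul _ _ _ _ (hb₂ x) (hN₂ u x)))) (hNw v x)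
    refine ((abs_sub _ _).trans (add_le_add hdiffusion hdrift)).trans_eq ?_
    rw [hA]
    ring
  have hpart₁ : |∫ x : ℝ × ℝ, ((1 / 2) * (σ₁ ^ 2 * d₁ u x * d₁ v x +
      ρ * σ₁ * σ₂ * (d₁ u x * d₂ v x + d₂ u x * d₁ v x) + σ₂ ^ 2 * d₂ u x * d₂ v x) -
      (((r - σ₁ ^ 2 / 2) + K₁ x) * d₁ u x + ((r - σ₂ ^ 2 / 2) + K₂ x) * d₂ u x) * v x.1 x.2) *
      W x| ≤ A * S := by
    rw [← Real.norm_eq_abs]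
    refine (norm_integral_le_of_norm_le (hNN.const_mul A) (.of_forall fun x => ?_)).trans ?_
    · rw [Real.norm_eq_abs, abs_mul, abs_of_nonneg (hW0 x), ← mul_assoc]
      exact mul_le_mul_of_nonneg_right (hlocal x) (hW0 x)
    · rw [integral_const_mul]
      exact mul_le_mul_of_nonneg_left hCS (by positivity)
  -- the jump part
  obtain ⟨hI₁, hT₁⟩ := integrable_and_integral_convolution_mul_mul_le (μ := volume)
    (by linarith : 0 ≤ 2 * η₁) hk₁0 hk₁ (hexp₁ _) hNu hNuc (hN0 u) hNv hNvc (hN0 v) hW hW0 hshift₁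
  obtain ⟨hI₂, hT₂⟩ := integrable_and_integral_convolution_mul_mul_le (μ := volume)
    (by linarith : 0 ≤ 2 * η₂) hk₂0 hk₂ (hexp₂ _) hNu hNuc (hN0 u) hNv hNvc (hN0 v) hW hW0 hshift₂
  rw [← hH, ← hH, ← hS] at hT₁ hT₂
  obtain ⟨B, hB⟩ := hNuc.exists_bound_of_continuous hNu
  have hconv : ∀ (e x : ℝ × ℝ) (k : ℝ → ℝ), Integrable k →
      Integrable fun y => N u (x + y • e) * k y := fun e x k hk =>
    hk.bdd_mul (c := B) (by fun_prop : Continuous fun y : ℝ => N u (x + y • e)).aestronglyMeasurable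
      (.of_forall fun y => hB _)
  have hJ : ∀ x, |J u x| ≤ (∫ y, N u (x + y • ((1 : ℝ), (0 : ℝ))) * k₁ y) +
      (∫ y, N u (x + y • ((0 : ℝ), (1 : ℝ))) * k₂ y) + (M₁ + M₂) * N u x := fun x => by
    have h₁ := abs_integral_jump_le (φ := fun y => u (x.1 + y) x.2) hk₁0 hk₁ (hexp₁ 1)
      (hconv (1, 0) x k₁ hk₁) (fun y => by simpa using hNw u (x + y • ((1 : ℝ), (0 : ℝ))))
      (hNw u x) (hN₁ u x)
    have h₂ := abs_integral_jump_le (φ := fun y => u x.1 (x.2 + y)) hk₂0 hk₂ (hexp₂ 1)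
      (hconv (0, 1) x k₂ hk₂) (fun y => by simpa using hNw u (x + y • ((0 : ℝ), (1 : ℝ))))
      (hNw u x) (hN₂ u x)
    refine ((abs_add_le _ _).trans (add_le_add h₁ h₂)).trans_eq ?_
    ring
  have hpart₂ : |∫ x : ℝ × ℝ, J u x * v x.1 x.2 * W x| ≤ (Λ₁ + Λ₂ + (M₁ + M₂)) * S := by
    rw [← Real.norm_eq_abs]
    refine (norm_integral_le_of_norm_le ((hI₁.add hI₂).add (hNN.const_mul (M₁ + M₂)))
      (.of_forall fun x => ?_)).trans ?_
    · rw [Real.norm_eq_abs, abs_mul, abs_of_nonneg (hW0 x)]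
      refine (mul_le_mul_of_nonneg_right (hmul _ _ _ _ (hJ x) (hNw v x)) (hW0 x)).trans_eq ?_
      simp only [Pi.add_apply]
      ring
    · rw [integral_add' (hI₁.add hI₂) (hNN.const_mul (M₁ + M₂)), integral_add' hI₁ hI₂,
        integral_const_mul, add_mul (Λ₁ + Λ₂), add_mul Λ₁]
      exact add_le_add (add_le_add hT₁ hT₂)
        (mul_le_mul_of_nonneg_left hCS (add_nonneg hM₁0 hM₂0))
  rw [mul_assoc, add_mul]
  exact (abs_sub _ _).trans (add_le_add hpart₁ hpart₂)
end
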